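/- The gradient identity underlying the irreducible mass monotonicity: for M > 0, J real with J² < M⁴, setting f(M,J) = (M² + √(M⁴-J²))/2, one has ∂f/∂J = -Ω_H · ∂f/∂M where Ω_H = a/(r₊²+a²), a = J/M, r₊ = M + √(M²-a²); moreover ∂f/∂M > 0. -/

import Mathlib

theorem hasDerivAt_irreducible_mass_sq_mass {M J : ℝ} (hJ : J ^ 2 < M ^ 4) :
    HasDerivAt (fun m : ℝ => (m ^ 2 + Real.sqrt (m ^ 4 - J ^ 2)) / 2)
      (M + M ^ 3 / Real.sqrt (M ^ 4 - J ^ 2)) M := by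
  have hpos : 0 < M ^ 4 - J ^ 2 := by linarith
  have hs : Real.sqrt (M ^ 4 - J ^ 2) ≠ 0 := (Real.sqrt_pos.mpr hpos).ne'
  refine (((hasDerivAt_pow 2 M).add
    (((hasDerivAt_pow 4 M).sub_const (J ^ 2)).sqrt hpos.ne')).div_const 2).congr_deriv ?_
  field_simp
  push_cast
  ring

theorem hasDerivAt_irreducible_mass_sq_angular_momentum {M J : ℝ} (hJ : J ^ 2 < M ^ 4) :
    HasDerivAt (fun j : ℝ => (M ^ 2 + Real.sqrt (M ^ 4 - j ^ 2)) / 2)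
      (-J / (2 * Real.sqrt (M ^ 4 - J ^ 2))) J := by
  have hpos : 0 < M ^ 4 - J ^ 2 := by linarith
  have hs : Real.sqrt (M ^ 4 - J ^ 2) ≠ 0 := (Real.sqrt_pos.mpr hpos).ne'
  refine (((((hasDerivAt_pow 2 J).const_sub (M ^ 4)).sqrt hpos.ne').const_add
    (M ^ 2)).div_const 2).congr_deriv ?_
  field_simp
  push_cast
  ring

theorem sqrt_sq_sub_div_sq {M : ℝ} (hM : 0 < M) (J : ℝ) :
    Real.sqrt (M ^ 2 - (J / M) ^ 2) = Real.sqrt (M ^ 4 - J ^ 2) / M := by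
  have h : M ^ 2 - (J / M) ^ 2 = (M ^ 4 - J ^ 2) / M ^ 2 := by
    field_simp
  rw [h, Real.sqrt_div' _ (sq_nonneg M), Real.sqrt_sq hM.le]

/-- Gradient identity: ∂f/∂J = -Ω_H ∂f/∂M and ∂f/∂M > 0 for f = M_irr². -/
theorem irreducible_mass_gradient (M J : ℝ) (hM : 0 < M) (hJ : J^2 < M^4)
    (a rp ΩH fM fJ : ℝ)
    (ha : a = J / M)
    (hrp : rp = M + Real.sqrt (M^2 - a^2))
    (hΩH : ΩH = a / (rp^2 + a^2))
    (hfM : fM = deriv (fun m : ℝ => (m^2 + Real.sqrt (m^4 - J^2)) / 2) M)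
    (hfJ : fJ = deriv (fun j : ℝ => (M^2 + Real.sqrt (M^4 - j^2)) / 2) J) :
    fJ = -ΩH * fM ∧ 0 < fM := by
  rw [(hasDerivAt_irreducible_mass_sq_mass hJ).deriv] at hfM
  rw [(hasDerivAt_irreducible_mass_sq_angular_momentum hJ).deriv] at hfJ
  rw [ha, sqrt_sq_sub_div_sq hM] at hrp
  have hpos : 0 < M ^ 4 - J ^ 2 := by linarith
  have hS : 0 < Real.sqrt (M ^ 4 - J ^ 2) := Real.sqrt_pos.mpr hpos
  have hSq : Real.sqrt (M ^ 4 - J ^ 2) ^ 2 = M ^ 4 - J ^ 2 := Real.sq_sqrt hpos.le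
  generalize Real.sqrt (M ^ 4 - J ^ 2) = S at *
  have hden : rp ^ 2 + a ^ 2 = 2 * (M ^ 2 + S) := by
    rw [hrp, ha]
    field_simp
    linear_combination hSq
  have hsum : M ^ 2 + S ≠ 0 := by positivity
  refine ⟨?_, by rw [hfM]; positivity⟩
  rw [hfJ, hΩH, hden, hfM, ha]
  field_simp
  ring
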